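/- Let δ > 0 and let φ : ℝ → ℝ be an integrable, compactly supported function that is smooth on a neighborhood of [0, δ], and let ℓ be a positive integer. Then there exists a constant C ∈ ℝ such that, as ε → 0⁺, ∫_ε^∞ t^{−ℓ} φ(t) dt = Σ_{j=1}^{ℓ−1} [1/(ℓ−j)]·[φ^{(j−1)}(0)/(j−1)!]·ε^{−ℓ+j} − [φ^{(ℓ−1)}(0)/(ℓ−1)!]·log ε + C + O(ε). -/

import Mathlib

open MeasureTheory Filter Asymptotics

lemma integrableOn_Ioi_zpow_neg_mul {φ : ℝ → ℝ} {a : ℝ} (ha : 0 < a)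
    (hφ : IntegrableOn φ (Set.Ioi a)) (n : ℕ) :
    IntegrableOn (fun t => t ^ (-(n : ℤ)) * φ t) (Set.Ioi a) := by
  refine Integrable.bdd_mul (c := a ^ (-(n : ℤ))) hφ
    (by fun_prop : Measurable fun t : ℝ => t ^ (-(n : ℤ))).aestronglyMeasurable ?_
  filter_upwards [ae_restrict_mem measurableSet_Ioi] with t (ht : a < t)
  have h0 : 0 < t := ha.trans ht
  rw [Real.norm_of_nonneg (by positivity), zpow_neg, zpow_neg, zpow_natCast, zpow_natCast]
  gcongr

lemma exists_abs_sub_taylor_le {φ : ℝ → ℝ} {δ : ℝ} (hδ : 0 < δ) {U : Set ℝ} (hU : IsOpen U)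
    (hδU : Set.Icc 0 δ ⊆ U) (n : ℕ) (hφ : ContDiffOn ℝ (n + 1 : ℕ) φ U) :
    ∃ M : ℝ, ∀ t ∈ Set.Icc 0 δ,
      |φ t - ∑ k ∈ Finset.range (n + 1), iteratedDeriv k φ 0 / k.factorial * t ^ k|
        ≤ M * t ^ (n + 1) := by
  obtain ⟨M, hM⟩ := exists_taylor_mean_remainder_bound hδ.le
    (n := n) (by exact_mod_cast hφ.mono hδU)
  refine ⟨M, fun t ht => ?_⟩
  have h0 : (0 : ℝ) ∈ Set.Icc 0 δ := ⟨le_rfl, hδ.le⟩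
  have h := hM t ht
  rw [taylor_within_apply, Real.norm_eq_abs, sub_zero] at h
  refine le_of_eq_of_le ?_ h
  congr 2
  refine Finset.sum_congr rfl fun k hk => ?_
  have hk' : k ≤ n + 1 := (Finset.mem_range.1 hk).le
  rw [iteratedDerivWithin_eq_iteratedDeriv (uniqueDiffOn_Icc hδ)
    ((hφ.contDiffAt (hU.mem_nhds (hδU h0))).of_le (by exact_mod_cast hk')) h0, smul_eq_mul]
  ring

lemma integral_zpow_neg_mul_polynomial {ε δ : ℝ} (hε : 0 < ε) (hδ : 0 < δ) (a : ℕ → ℝ) (n : ℕ) :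
    ∫ t in ε..δ, t ^ (-((n + 1 : ℕ) : ℤ)) * ∑ k ∈ Finset.range (n + 1), a k * t ^ k =
      (∑ k ∈ Finset.range n, a k / ((n : ℝ) - k) * ε ^ ((k : ℤ) - n) - a n * Real.log ε)
      - (∑ k ∈ Finset.range n, a k / ((n : ℝ) - k) * δ ^ ((k : ℤ) - n) - a n * Real.log δ) := by
  have h0 : (0 : ℝ) ∉ Set.uIcc ε δ := Set.notMem_uIcc_of_lt hε hδ
  have hcongr : Set.EqOn
      (fun t : ℝ => t ^ (-((n + 1 : ℕ) : ℤ)) * ∑ k ∈ Finset.range (n + 1), a k * t ^ k)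
      (fun t => ∑ k ∈ Finset.range (n + 1), a k * t ^ ((k : ℤ) - n - 1)) (Set.uIcc ε δ) := by
    intro t ht
    have ht0 : t ≠ 0 := fun h => h0 (h ▸ ht)
    simp only [Finset.mul_sum]
    refine Finset.sum_congr rfl fun k _ => ?_
    rw [← zpow_natCast t k, mul_left_comm, ← zpow_add₀ ht0]
    congr 2
    push_cast
    ring
  rw [intervalIntegral.integral_congr hcongr, intervalIntegral.integral_finsetSum
    fun k _ => (intervalIntegral.intervalIntegrable_zpow (Or.inr h0)).const_mul _,
    Finset.sum_range_succ]
  have hlog : ∫ t in ε..δ, a n * t ^ ((n : ℤ) - n - 1) = a n * (Real.log δ - Real.log ε) := by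
    rw [intervalIntegral.integral_const_mul, sub_self, zero_sub]
    simp only [zpow_neg_one]
    rw [integral_inv h0, Real.log_div hδ.ne' hε.ne']
  have hpow : ∀ k ∈ Finset.range n, ∫ t in ε..δ, a k * t ^ ((k : ℤ) - n - 1) =
      a k / ((n : ℝ) - k) * ε ^ ((k : ℤ) - n) - a k / ((n : ℝ) - k) * δ ^ ((k : ℤ) - n) := by
    intro k hk
    have hkn := Finset.mem_range.1 hk
    have hne : (n : ℝ) - k ≠ 0 := sub_ne_zero.2 (by exact_mod_cast hkn.ne')
    have hne' : (k : ℝ) - n ≠ 0 := sub_ne_zero.2 (by exact_mod_cast hkn.ne)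
    rw [intervalIntegral.integral_const_mul, integral_zpow (Or.inr ⟨by omega, h0⟩)]
    push_cast
    simp only [sub_add_cancel]
    rw [← neg_sub (n : ℝ) k]
    field_simp
    ring
  rw [hlog, Finset.sum_congr rfl hpow, Finset.sum_sub_distrib]
  ring

/-- If `φ` agrees with a polynomial of degree `n` up to `O(t ^ (n + 1))` on `(0, δ]`, then the
truncated integral of `t ^ (-(n + 1)) * φ t` has a Hadamard expansion determined by the
coefficients of that polynomial. -/
lemma exists_isBigO_integral_Ioi_zpow_neg_mul {φ : ℝ → ℝ} {δ M : ℝ} (hδ : 0 < δ)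
    (hint : IntegrableOn φ (Set.Ioi 0)) (a : ℕ → ℝ) (n : ℕ)
    (hM : ∀ t ∈ Set.Ioc 0 δ,
      |φ t - ∑ k ∈ Finset.range (n + 1), a k * t ^ k| ≤ M * t ^ (n + 1)) :
    ∃ C : ℝ, (fun ε : ℝ => (∫ t in Set.Ioi ε, t ^ (-((n + 1 : ℕ) : ℤ)) * φ t)
        - ∑ k ∈ Finset.range n, a k / ((n : ℝ) - k) * ε ^ ((k : ℤ) - n)
        + a n * Real.log ε - C)
      =O[nhdsWithin 0 (Set.Ioi 0)] (fun ε : ℝ => ε) := by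
  set P : ℝ → ℝ := fun t => ∑ k ∈ Finset.range (n + 1), a k * t ^ k with hP
  have hPc : Continuous P := by fun_prop
  set r : ℝ → ℝ := fun t => t ^ (-((n + 1 : ℕ) : ℤ)) * (φ t - P t) with hr
  have hrM : ∀ t ∈ Set.Ioc 0 δ, ‖r t‖ ≤ M := by
    intro t ht
    have ht0 : 0 < t := ht.1
    have h := hM t ht
    rw [hr, norm_mul, Real.norm_of_nonneg (by positivity), zpow_neg, zpow_natCast,
      inv_mul_le_iff₀ (by positivity), mul_comm]
    exact h
  have hri : IntegrableOn r (Set.Ioc 0 δ) := by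
    refine Integrable.of_bound ?_ M ?_
    · have hpow : Measurable fun t : ℝ => t ^ (-((n + 1 : ℕ) : ℤ)) := by fun_prop
      exact hpow.aestronglyMeasurable.mul
        (((hint.mono_set Set.Ioc_subset_Ioi_self).aestronglyMeasurable).sub
          hPc.aestronglyMeasurable)
    · exact (ae_restrict_mem measurableSet_Ioc).mono hrM
  refine ⟨(∫ t in Set.Ioi δ, t ^ (-((n + 1 : ℕ) : ℤ)) * φ t) + (∫ t in (0 : ℝ)..δ, r t)
    - (∑ k ∈ Finset.range n, a k / ((n : ℝ) - k) * δ ^ ((k : ℤ) - n) - a n * Real.log δ), ?_⟩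
  refine IsBigO.of_bound M ?_
  filter_upwards [Ioo_mem_nhdsGT hδ] with ε ⟨hε, hεδ⟩
  have hφε := integrableOn_Ioi_zpow_neg_mul hε (hint.mono_set (Set.Ioi_subset_Ioi hε.le)) (n + 1)
  have hri0 : IntervalIntegrable r volume 0 ε :=
    (intervalIntegrable_iff_integrableOn_Ioc_of_le hε.le).2
      (hri.mono_set (Set.Ioc_subset_Ioc_right hεδ.le))
  have hriδ : IntervalIntegrable r volume ε δ :=
    (intervalIntegrable_iff_integrableOn_Ioc_of_le hεδ.le).2
      (hri.mono_set (Set.Ioc_subset_Ioc_left hε.le))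
  have hPi : IntervalIntegrable (fun t => t ^ (-((n + 1 : ℕ) : ℤ)) * P t) volume ε δ :=
    (intervalIntegral.intervalIntegrable_zpow
      (Or.inr (Set.notMem_uIcc_of_lt hε hδ))).mul_continuousOn hPc.continuousOn
  have hsplit := intervalIntegral.integral_Ioi_sub_Ioi hφε hεδ.le
  have hφP : ∫ t in ε..δ, t ^ (-((n + 1 : ℕ) : ℤ)) * φ t =
      (∫ t in ε..δ, r t) + ∫ t in ε..δ, t ^ (-((n + 1 : ℕ) : ℤ)) * P t := by
    rw [← intervalIntegral.integral_add hriδ hPi]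
    refine intervalIntegral.integral_congr fun t _ => ?_
    simp only [hr]
    ring
  have hpoly := integral_zpow_neg_mul_polynomial hε hδ a n
  have hradd := intervalIntegral.integral_add_adjacent_intervals hri0 hriδ
  have hbound : ‖∫ t in (0 : ℝ)..ε, r t‖ ≤ M * |ε - 0| := by
    refine intervalIntegral.norm_integral_le_of_norm_le_const fun t ht => hrM t ?_
    rw [Set.uIoc_of_le hε.le] at ht
    exact ⟨ht.1, ht.2.trans hεδ.le⟩
  rw [sub_zero, ← norm_neg] at hbound
  refine le_of_eq_of_le (congrArg _ ?_) hbound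
  simp only [hP] at hφP
  linarith

/-- Hadamard-type expansion of the truncated integral `∫_ε^∞ t^{-ℓ} φ(t) dt` as `ε → 0⁺`. -/
theorem stmt1 (δ : ℝ) (hδ : 0 < δ) (φ : ℝ → ℝ)
    (hint : Integrable φ) (hsupp : HasCompactSupport φ)
    (hsm : ∃ U : Set ℝ, IsOpen U ∧ Set.Icc 0 δ ⊆ U ∧ ContDiffOn ℝ (⊤ : ℕ∞) φ U)
    (ℓ : ℕ) (hℓ : 1 ≤ ℓ) :
    ∃ C : ℝ,
      (fun ε : ℝ =>
          (∫ t in Set.Ioi ε, t ^ (-(ℓ : ℤ)) * φ t)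
            - (∑ j ∈ Finset.Icc 1 (ℓ - 1),
                (1 / ((ℓ : ℝ) - (j : ℝ))) *
                  (iteratedDeriv (j - 1) φ 0 / (Nat.factorial (j - 1))) *
                    ε ^ (-(ℓ : ℤ) + (j : ℤ)))
            + (iteratedDeriv (ℓ - 1) φ 0 / (Nat.factorial (ℓ - 1))) * Real.log ε
            - C)
        =O[nhdsWithin 0 (Set.Ioi 0)] (fun ε : ℝ => ε) := by
  obtain ⟨U, hU, hδU, hφ⟩ := hsm
  obtain ⟨n, rfl⟩ := Nat.exists_eq_add_of_le' hℓ
  obtain ⟨M, hM⟩ := exists_abs_sub_taylor_le hδ hU hδU n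
    (hφ.of_le (by exact_mod_cast le_top))
  obtain ⟨C, hC⟩ := exists_isBigO_integral_Ioi_zpow_neg_mul hδ hint.integrableOn
    (fun k => iteratedDeriv k φ 0 / k.factorial) n fun t ht => hM t (Set.Ioc_subset_Icc_self ht)
  refine ⟨C, hC.congr_left fun ε => ?_⟩
  have hsum : ∑ j ∈ Finset.Icc 1 n, (1 / (((n + 1 : ℕ) : ℝ) - (j : ℝ))) *
        (iteratedDeriv (j - 1) φ 0 / (Nat.factorial (j - 1))) *
          ε ^ (-((n + 1 : ℕ) : ℤ) + (j : ℤ)) =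
      ∑ k ∈ Finset.range n,
        iteratedDeriv k φ 0 / k.factorial / ((n : ℝ) - k) * ε ^ ((k : ℤ) - n) := by
    rw [← Finset.Ico_add_one_right_eq_Icc, Finset.sum_Ico_eq_sum_range, Nat.add_sub_cancel]
    refine Finset.sum_congr rfl fun k _ => ?_
    rw [Nat.add_sub_cancel_left]
    have hexp : -((n + 1 : ℕ) : ℤ) + ((1 + k : ℕ) : ℤ) = (k : ℤ) - n := by
      push_cast
      ring
    have hcoeff : ((n + 1 : ℕ) : ℝ) - ((1 + k : ℕ) : ℝ) = (n : ℝ) - k := by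
      push_cast
      ring
    rw [hexp, hcoeff, one_div_mul_eq_div]
  simp only [Nat.add_sub_cancel, hsum]
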